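/- Let N ≥ 2, let a be an antisymmetric N×N complex matrix (aᵗ = −a), let b and c be N×N complex matrices, set A = (0, a; a*, 0) and B = diag(b, c) as 2N×2N block matrices, and let U range over the matrices diag(V, V̄) with V drawn from the normalized Haar measure on U(N). Then ⟨Tr(U*AUBU*AUB)⟩ = Tr(A²)·(Tr(b)·Tr(c) − Tr(b·cᵗ)) / (N(N−1)). -/

import Mathlib

open MeasureTheory Matrix

noncomputable instance (m n α : Type*) [MeasurableSpace α] : MeasurableSpace (Matrix m n α) :=
  (inferInstance : MeasurableSpace (m → n → α))

/-- The `2N×2N` block-diagonal matrix `diag(V, V̄)` built from an `N×N` matrix `V`. -/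
def Ublk {N : ℕ} (V : Matrix (Fin N) (Fin N) ℂ) :
    Matrix (Fin N ⊕ Fin N) (Fin N ⊕ Fin N) ℂ :=
  Matrix.fromBlocks V 0 0 Vᴴᵀ

lemma measurable_matrix_entry {m n α : Type*} [MeasurableSpace α] (i : m) (j : n) :
    Measurable (fun V : Matrix m n α => V i j) :=
  (measurable_pi_apply j).comp (measurable_pi_apply (X := fun _ : m => n → α) i)

lemma measurable_matrix_mul_left {N : ℕ} (S : Matrix (Fin N) (Fin N) ℂ) :
    Measurable (fun V : Matrix (Fin N) (Fin N) ℂ => S * V) := by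
  refine measurable_pi_iff.2 fun i => measurable_pi_iff.2 fun j => ?_
  simp only [Matrix.mul_apply]
  exact Finset.measurable_sum _ fun k _ => (measurable_matrix_entry k j).const_mul _

/-- The `2×2` minor of `V` in rows `p, q` and columns `i, j`. -/
def minorTwo {N : ℕ} (V : Matrix (Fin N) (Fin N) ℂ) (i j p q : Fin N) : ℂ :=
  V p i * V q j - V q i * V p j

lemma measurable_minorTwo {N : ℕ} (i j p q : Fin N) :
    Measurable (fun V : Matrix (Fin N) (Fin N) ℂ => minorTwo V i j p q) :=
  ((measurable_matrix_entry p i).mul (measurable_matrix_entry q j)).sub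
    ((measurable_matrix_entry q i).mul (measurable_matrix_entry p j))

lemma norm_minorTwo_le {N : ℕ} {V : Matrix (Fin N) (Fin N) ℂ}
    (hV : V ∈ Matrix.unitaryGroup (Fin N) ℂ) (i j p q : Fin N) : ‖minorTwo V i j p q‖ ≤ 2 := by
  have h : ∀ r s, ‖V r s‖ ≤ 1 := entry_norm_bound_of_unitary hV
  calc ‖minorTwo V i j p q‖ ≤ ‖V p i‖ * ‖V q j‖ + ‖V q i‖ * ‖V p j‖ := by
        simpa only [minorTwo, norm_mul] using norm_sub_le (V p i * V q j) (V q i * V p j)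
    _ ≤ 1 * 1 + 1 * 1 := by gcongr <;> exact h _ _
    _ = 2 := by norm_num

lemma measurable_star_minorTwo_mul {N : ℕ} (i j k l p q r s : Fin N) :
    Measurable (fun V : Matrix (Fin N) (Fin N) ℂ =>
      star (minorTwo V i j p q) * minorTwo V k l r s) :=
  (continuous_star.measurable.comp (measurable_minorTwo i j p q)).mul (measurable_minorTwo k l r s)

section Haar

variable {N : ℕ} {μ : Measure (Matrix (Fin N) (Fin N) ℂ)}

lemma integrable_star_minorTwo_mul [IsFiniteMeasure μ]
    (hmem : ∀ᵐ V ∂μ, V ∈ Matrix.unitaryGroup (Fin N) ℂ) (i j k l p q r s : Fin N) :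
    Integrable (fun V => star (minorTwo V i j p q) * minorTwo V k l r s) μ := by
  refine Integrable.of_bound (measurable_star_minorTwo_mul ..).aestronglyMeasurable 4 ?_
  filter_upwards [hmem] with V hV
  rw [norm_mul, norm_star]
  nlinarith [norm_minorTwo_le hV i j p q, norm_minorTwo_le hV k l r s,
    norm_nonneg (minorTwo V i j p q), norm_nonneg (minorTwo V k l r s)]

lemma integral_comp_unitary_mul
    (hinv : ∀ S ∈ Matrix.unitaryGroup (Fin N) ℂ, μ.map (fun V => S * V) = μ)
    {S : Matrix (Fin N) (Fin N) ℂ} (hS : S ∈ Matrix.unitaryGroup (Fin N) ℂ)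
    {f : Matrix (Fin N) (Fin N) ℂ → ℂ} (hf : Measurable f) :
    ∫ V, f (S * V) ∂μ = ∫ V, f V ∂μ := by
  conv_rhs => rw [← hinv S hS]
  exact (integral_map (measurable_matrix_mul_left S).aemeasurable hf.aestronglyMeasurable).symm

/-- The second moments of the `2×2` minors with columns `i, j` and `k, l`. -/
noncomputable def minorMoment (μ : Measure (Matrix (Fin N) (Fin N) ℂ)) (i j k l p q r s : Fin N) : ℂ :=
  ∫ V, star (minorTwo V i j p q) * minorTwo V k l r s ∂μ

lemma minorMoment_perm
    (hinv : ∀ S ∈ Matrix.unitaryGroup (Fin N) ℂ, μ.map (fun V => S * V) = μ)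
    (i j k l p q r s : Fin N) (σ : Equiv.Perm (Fin N)) :
    minorMoment μ i j k l (σ p) (σ q) (σ r) (σ s) = minorMoment μ i j k l p q r s := by
  have hS : σ.permMatrix ℂ ∈ Matrix.unitaryGroup (Fin N) ℂ := by
    rw [Matrix.mem_unitaryGroup_iff, Matrix.star_eq_conjTranspose, Matrix.conjTranspose_permMatrix,
      ← Matrix.permMatrix_mul]
    simp
  unfold minorMoment
  rw [← integral_comp_unitary_mul hinv hS (measurable_star_minorTwo_mul i j k l p q r s)]
  simp [minorTwo, Equiv.Perm.permMatrix, PEquiv.toMatrix_toPEquiv_mul]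

lemma minorMoment_diagonal
    (hinv : ∀ S ∈ Matrix.unitaryGroup (Fin N) ℂ, μ.map (fun V => S * V) = μ)
    (i j k l p q r s : Fin N) (ε : Fin N → ℝ) (hε : ∀ t, ε t * ε t = 1) :
    minorMoment μ i j k l p q r s =
      ε p * ε q * ε r * ε s * minorMoment μ i j k l p q r s := by
  have hS : Matrix.diagonal (fun t => (ε t : ℂ)) ∈ Matrix.unitaryGroup (Fin N) ℂ := by
    rw [Matrix.mem_unitaryGroup_iff, Matrix.star_eq_conjTranspose,
      Matrix.diagonal_conjTranspose, Matrix.diagonal_mul_diagonal, ← Matrix.diagonal_one]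
    congr 1
    ext t
    simp [← Complex.ofReal_mul, hε]
  unfold minorMoment
  conv_lhs =>
    rw [← integral_comp_unitary_mul hinv hS (measurable_star_minorTwo_mul i j k l p q r s)]
  rw [← integral_const_mul]
  congr 1
  ext V
  simp only [minorTwo, Matrix.diagonal_mul, star_sub, star_mul', Complex.star_def,
    Complex.conj_ofReal]
  ring

lemma minorMoment_swap_left (i j k l p q r s : Fin N) :
    minorMoment μ i j k l q p r s = -minorMoment μ i j k l p q r s := by
  simp only [minorMoment, ← integral_neg, minorTwo, star_sub]
  congr 1; ext V; ring

lemma minorMoment_swap_right (i j k l p q r s : Fin N) :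
    minorMoment μ i j k l p q s r = -minorMoment μ i j k l p q r s := by
  simp only [minorMoment, ← integral_neg, minorTwo]
  congr 1; ext V; ring

lemma minorMoment_self_left (i j k l p r s : Fin N) : minorMoment μ i j k l p p r s = 0 := by
  simp [minorMoment, minorTwo]

lemma minorMoment_self_right (i j k l p q r : Fin N) : minorMoment μ i j k l p q r r = 0 := by
  simp [minorMoment, minorTwo]

lemma minorMoment_eq_zero
    (hinv : ∀ S ∈ Matrix.unitaryGroup (Fin N) ℂ, μ.map (fun V => S * V) = μ)
    (i j k l p q r s : Fin N) (hpq : p ≠ q) (hr : p ≠ r) (hs : p ≠ s) :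
    minorMoment μ i j k l p q r s = 0 := by
  have h := minorMoment_diagonal hinv i j k l p q r s (fun t => if t = p then -1 else 1)
    (fun t => by split_ifs <;> norm_num)
  simp only [if_true, if_neg hpq.symm, if_neg hr.symm, if_neg hs.symm] at h
  push_cast at h
  linear_combination h / 2

lemma exists_perm_pair {α : Type*} [DecidableEq α] {p q p' q' : α} (h : p ≠ q) (h' : p' ≠ q') :
    ∃ σ : Equiv.Perm α, σ p = p' ∧ σ q = q' := by
  refine ⟨Equiv.swap (Equiv.swap p p' q) q' * Equiv.swap p p', ?_, by simp⟩
  have : p' ≠ Equiv.swap p p' q := fun e => h ((Equiv.swap p p').injective (by simpa using e))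
  simp [Equiv.swap_apply_of_ne_of_ne this h']

lemma minorMoment_eq_const
    (hinv : ∀ S ∈ Matrix.unitaryGroup (Fin N) ℂ, μ.map (fun V => S * V) = μ)
    (i j k l : Fin N) {p₀ q₀ : Fin N} (h₀ : p₀ ≠ q₀) (p q r s : Fin N) :
    minorMoment μ i j k l p q r s = minorMoment μ i j k l p₀ q₀ p₀ q₀ *
      ((if p = r ∧ q = s then 1 else 0) - (if p = s ∧ q = r then 1 else 0)) := by
  have key : ∀ p q, p ≠ q →
      minorMoment μ i j k l p q p q = minorMoment μ i j k l p₀ q₀ p₀ q₀ := by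
    intro p q h
    obtain ⟨σ, rfl, rfl⟩ := exists_perm_pair h₀ h
    exact minorMoment_perm hinv ..
  by_cases hpq : p = q
  · subst hpq
    rw [minorMoment_self_left]
    simp [and_comm]
  by_cases hrs : r = s
  · subst hrs
    rw [minorMoment_self_right]
    simp
  by_cases h1 : p = r
  · subst h1
    by_cases h2 : q = s
    · subst h2
      simp [key p q hpq, hpq]
    · rw [← neg_neg (minorMoment μ i j k l p q p s), ← minorMoment_swap_left,
        minorMoment_eq_zero hinv _ _ _ _ _ _ _ _ (Ne.symm hpq) (Ne.symm hpq) h2]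
      simp [h2, hrs]
  by_cases h3 : p = s
  · subst h3
    by_cases h2 : q = r
    · subst h2
      rw [minorMoment_swap_right, key p q hpq]
      simp [hpq]
    · rw [← neg_neg (minorMoment μ i j k l p q r p), ← minorMoment_swap_left,
        minorMoment_eq_zero hinv _ _ _ _ _ _ _ _ (Ne.symm hpq) h2 (Ne.symm hpq)]
      simp [h2, h1]
  · rw [minorMoment_eq_zero hinv _ _ _ _ _ _ _ _ hpq h1 h3]
    simp [h1, h3]

lemma sum_star_minorTwo_mul {V : Matrix (Fin N) (Fin N) ℂ}
    (hV : V ∈ Matrix.unitaryGroup (Fin N) ℂ) (i j k l : Fin N) :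
    ∑ p, ∑ q, star (minorTwo V i j p q) * minorTwo V k l p q =
      2 * ((if i = k then 1 else 0) * (if j = l then 1 else 0) -
        (if i = l then 1 else 0) * (if j = k then 1 else 0)) := by
  have h : ∀ x y, ∑ p, star (V p x) * V p y = if x = y then 1 else 0 := by
    intro x y
    simpa [Matrix.mul_apply, Matrix.one_apply] using
      congrFun (congrFun (Matrix.mem_unitaryGroup_iff'.1 hV) x) y
  rw [← h i k, ← h j l, ← h i l, ← h j k]
  calc _ = ∑ p, ∑ q, ((star (V p i) * V p k) * (star (V q j) * V q l)
        - (star (V p i) * V p l) * (star (V q j) * V q k)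
        + ((star (V p j) * V p l) * (star (V q i) * V q k)
        - (star (V p j) * V p k) * (star (V q i) * V q l))) := by
        refine Finset.sum_congr rfl fun p _ => Finset.sum_congr rfl fun q _ => ?_
        simp only [minorTwo, star_sub, star_mul']
        ring
    _ = _ := by
        simp only [Finset.sum_add_distrib, Finset.sum_sub_distrib, ← Finset.mul_sum,
          ← Finset.sum_mul]
        ring

lemma minorMoment_base [IsProbabilityMeasure μ]
    (hmem : ∀ᵐ V ∂μ, V ∈ Matrix.unitaryGroup (Fin N) ℂ)
    (hinv : ∀ S ∈ Matrix.unitaryGroup (Fin N) ℂ, μ.map (fun V => S * V) = μ)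
    (i j k l : Fin N) {p₀ q₀ : Fin N} (h₀ : p₀ ≠ q₀) :
    (N : ℂ) * ((N : ℂ) - 1) * minorMoment μ i j k l p₀ q₀ p₀ q₀ =
      2 * ((if i = k then 1 else 0) * (if j = l then 1 else 0) -
        (if i = l then 1 else 0) * (if j = k then 1 else 0)) := by
  have h1 : ∑ p, ∑ q, minorMoment μ i j k l p q p q =
      2 * ((if i = k then 1 else 0) * (if j = l then 1 else 0) -
        (if i = l then 1 else 0) * (if j = k then 1 else 0)) := by
    simp only [minorMoment]
    have hi := integrable_star_minorTwo_mul hmem i j k l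
    simp_rw [← integral_finsetSum _ fun q _ => hi _ q _ q]
    rw [← integral_finsetSum _ fun p _ => integrable_finsetSum _ fun q _ => hi p q p q,
      integral_congr_ae (hmem.mono fun V hV => sum_star_minorTwo_mul hV i j k l)]
    simp
  have hg := minorMoment_eq_const hinv i j k l h₀
  rw [← h1]
  generalize minorMoment μ i j k l p₀ q₀ p₀ q₀ = g at hg ⊢
  simp_rw [hg]
  have h2 : ∀ p q : Fin N, (if p = q ∧ q = p then (1 : ℂ) else 0) = if p = q then 1 else 0 := by
    intro p q; simp [eq_comm]
  simp [h2, ← Finset.mul_sum]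
  ring

end Haar

lemma two_mul_conjTranspose_mul_mul_apply {N : ℕ} {a : Matrix (Fin N) (Fin N) ℂ} (ha : aᵀ = -a)
    (V : Matrix (Fin N) (Fin N) ℂ) (i j : Fin N) :
    2 * (Vᴴ * a * Vᴴᵀ) i j = ∑ p, ∑ q, a p q * star (minorTwo V i j p q) := by
  have ha' : ∀ p q, a q p = -a p q := fun p q => congrFun (congrFun ha p) q
  have h : (Vᴴ * a * Vᴴᵀ) i j = ∑ p, ∑ q, a p q * (star (V p i) * star (V q j)) := by
    simp only [Matrix.mul_apply, Matrix.conjTranspose_apply, Matrix.transpose_apply,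
      Finset.sum_mul]
    rw [Finset.sum_comm]
    exact Finset.sum_congr rfl fun p _ => Finset.sum_congr rfl fun q _ => by ring
  have h' : (Vᴴ * a * Vᴴᵀ) i j = -∑ p, ∑ q, a p q * (star (V q i) * star (V p j)) := by
    rw [h, Finset.sum_comm]
    simp only [← Finset.sum_neg_distrib]
    exact Finset.sum_congr rfl fun p _ => Finset.sum_congr rfl fun q _ => by rw [ha' p q]; ring
  rw [two_mul]
  nth_rewrite 1 [h]
  rw [h', ← sub_eq_add_neg]
  simp only [← Finset.sum_sub_distrib]
  refine Finset.sum_congr rfl fun p _ => Finset.sum_congr rfl fun q _ => ?_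
  simp only [minorTwo, star_sub, star_mul']
  ring

lemma trace_fromBlocks {m n R : Type*} [Fintype m] [Fintype n] [AddCommMonoid R]
    (A : Matrix m m R) (B : Matrix m n R) (C : Matrix n m R) (D : Matrix n n R) :
    (Matrix.fromBlocks A B C D).trace = A.trace + D.trace := by
  simp [Matrix.trace]

lemma trace_Ublk_conj {N : ℕ} (a b c V : Matrix (Fin N) (Fin N) ℂ) :
    ((Ublk V)ᴴ * Matrix.fromBlocks 0 a aᴴ 0 * Ublk V * Matrix.fromBlocks b 0 0 c *
        (Ublk V)ᴴ * Matrix.fromBlocks 0 a aᴴ 0 * Ublk V * Matrix.fromBlocks b 0 0 c).trace =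
      2 * ((Vᴴ * a * Vᴴᵀ) * c * (Vᴴ * a * Vᴴᵀ)ᴴ * b).trace := by
  have h : Vᴴᵀᴴ = Vᵀ := by ext; simp
  have hX : (Vᴴ * a * Vᴴᵀ)ᴴ = Vᵀ * aᴴ * V := by
    simp [Matrix.conjTranspose_mul, h, Matrix.mul_assoc]
  have hU : (Ublk V)ᴴ * Matrix.fromBlocks 0 a aᴴ 0 * Ublk V * Matrix.fromBlocks b 0 0 c =
      Matrix.fromBlocks 0 (Vᴴ * a * Vᴴᵀ * c) ((Vᴴ * a * Vᴴᵀ)ᴴ * b) 0 := by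
    rw [hX]
    simp [Ublk, Matrix.fromBlocks_conjTranspose, Matrix.fromBlocks_multiply, h]
  have : (Ublk V)ᴴ * Matrix.fromBlocks 0 a aᴴ 0 * Ublk V * Matrix.fromBlocks b 0 0 c *
        (Ublk V)ᴴ * Matrix.fromBlocks 0 a aᴴ 0 * Ublk V * Matrix.fromBlocks b 0 0 c =
      ((Ublk V)ᴴ * Matrix.fromBlocks 0 a aᴴ 0 * Ublk V * Matrix.fromBlocks b 0 0 c) *
      ((Ublk V)ᴴ * Matrix.fromBlocks 0 a aᴴ 0 * Ublk V * Matrix.fromBlocks b 0 0 c) := by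
    simp only [Matrix.mul_assoc]
  rw [this, hU, Matrix.fromBlocks_multiply, trace_fromBlocks]
  simp only [mul_zero, zero_add, add_zero]
  rw [Matrix.trace_mul_comm ((Vᴴ * a * Vᴴᵀ)ᴴ * b) (Vᴴ * a * Vᴴᵀ * c), ← two_mul,
    ← Matrix.mul_assoc]

lemma entry_mul_star_eq_sum {N : ℕ} {a : Matrix (Fin N) (Fin N) ℂ} (ha : aᵀ = -a)
    (V : Matrix (Fin N) (Fin N) ℂ) (i j k l : Fin N) :
    (Vᴴ * a * Vᴴᵀ) i j * star ((Vᴴ * a * Vᴴᵀ) k l) =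
      ∑ p, ∑ q, ∑ r, ∑ s, (1 / 4 * (a p q * star (a r s))) *
        (star (minorTwo V i j p q) * minorTwo V k l r s) := by
  have h1 := two_mul_conjTranspose_mul_mul_apply ha V i j
  have h2 := congrArg star (two_mul_conjTranspose_mul_mul_apply ha V k l)
  simp only [star_sum, star_mul', star_star, star_ofNat] at h2
  calc _ = 1 / 4 * ((2 * (Vᴴ * a * Vᴴᵀ) i j) * (2 * star ((Vᴴ * a * Vᴴᵀ) k l))) := by ring
    _ = _ := by
      rw [h1, h2]
      simp only [Finset.sum_mul]
      simp only [Finset.mul_sum]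
      exact Finset.sum_congr rfl fun p _ => Finset.sum_congr rfl fun q _ =>
        Finset.sum_congr rfl fun r _ => Finset.sum_congr rfl fun s _ => by ring

lemma integrable_entry_mul_star {N : ℕ} {a : Matrix (Fin N) (Fin N) ℂ} (ha : aᵀ = -a)
    {μ : Measure (Matrix (Fin N) (Fin N) ℂ)} [IsFiniteMeasure μ]
    (hmem : ∀ᵐ V ∂μ, V ∈ Matrix.unitaryGroup (Fin N) ℂ) (i j k l : Fin N) :
    Integrable (fun V => (Vᴴ * a * Vᴴᵀ) i j * star ((Vᴴ * a * Vᴴᵀ) k l)) μ := by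
  simp only [entry_mul_star_eq_sum ha]
  exact integrable_finsetSum _ fun p _ => integrable_finsetSum _ fun q _ =>
    integrable_finsetSum _ fun r _ => integrable_finsetSum _ fun s _ =>
      (integrable_star_minorTwo_mul hmem i j k l p q r s).const_mul _

lemma integral_entry_mul_star {N : ℕ} (hN : 2 ≤ N) {a : Matrix (Fin N) (Fin N) ℂ} (ha : aᵀ = -a)
    {μ : Measure (Matrix (Fin N) (Fin N) ℂ)} [IsProbabilityMeasure μ]
    (hmem : ∀ᵐ V ∂μ, V ∈ Matrix.unitaryGroup (Fin N) ℂ)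
    (hinv : ∀ S ∈ Matrix.unitaryGroup (Fin N) ℂ, μ.map (fun V => S * V) = μ) (i j k l : Fin N) :
    ∫ V, (Vᴴ * a * Vᴴᵀ) i j * star ((Vᴴ * a * Vᴴᵀ) k l) ∂μ =
      (a * aᴴ).trace / ((N : ℂ) * ((N : ℂ) - 1)) *
        ((if i = k then 1 else 0) * (if j = l then 1 else 0) -
          (if i = l then 1 else 0) * (if j = k then 1 else 0)) := by
  have ha' : ∀ p q, a q p = -a p q := fun p q => congrFun (congrFun ha p) q
  obtain ⟨p₀, q₀, h₀⟩ : ∃ p₀ q₀ : Fin N, p₀ ≠ q₀ :=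
    ⟨⟨0, by omega⟩, ⟨1, by omega⟩, by simp⟩
  have hN0 : (N : ℂ) ≠ 0 := by
    exact_mod_cast (by omega : N ≠ 0)
  have hN1 : (N : ℂ) - 1 ≠ 0 := by
    rw [sub_ne_zero]
    exact_mod_cast (by omega : N ≠ 1)
  have hi := integrable_star_minorTwo_mul hmem i j k l
  have hsum : ∀ p q, ∑ r, ∑ s, (1 / 4 * (a p q * star (a r s))) *
      ((if p = r ∧ q = s then 1 else 0) - (if p = s ∧ q = r then 1 else 0)) =
        1 / 2 * (a p q * star (a p q)) := by
    intro p q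
    simp only [mul_sub, mul_ite, mul_one, mul_zero, Finset.sum_sub_distrib, ite_and]
    simp [ha' p q]
    ring
  have hb := minorMoment_base hmem hinv i j k l h₀
  have hg := minorMoment_eq_const hinv i j k l h₀
  generalize minorMoment μ i j k l p₀ q₀ p₀ q₀ = g at hb hg
  have hint : ∫ V, (Vᴴ * a * Vᴴᵀ) i j * star ((Vᴴ * a * Vᴴᵀ) k l) ∂μ =
      g * (1 / 2 * (a * aᴴ).trace) := by
    simp only [entry_mul_star_eq_sum ha]
    have hi4 := fun p q r s => (hi p q r s).const_mul (1 / 4 * (a p q * star (a r s)))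
    have hi3 := fun p q r => integrable_finsetSum Finset.univ fun s _ => hi4 p q r s
    have hi2 := fun p q => integrable_finsetSum Finset.univ fun r _ => hi3 p q r
    have hi1 := fun p => integrable_finsetSum Finset.univ fun q _ => hi2 p q
    rw [integral_finsetSum _ fun p _ => hi1 p]
    simp only [integral_finsetSum _ fun q _ => hi2 _ q]
    simp only [integral_finsetSum _ fun r _ => hi3 _ _ r]
    simp only [integral_finsetSum _ fun s _ => hi4 _ _ _ s, integral_const_mul]
    simp only [← minorMoment.eq_def]
    simp only [hg, mul_left_comm _ g, ← Finset.mul_sum]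
    simp only [hsum, ← Finset.mul_sum]
    simp [Matrix.trace, Matrix.mul_apply]
  rw [hint, div_mul_eq_mul_div _ _ (_ - _), eq_div_iff (mul_ne_zero hN0 hN1)]
  linear_combination (1 / 2 * (a * aᴴ).trace) * hb

lemma trace_mul_mul_conjTranspose_mul {n : Type*} [Fintype n] (M c b : Matrix n n ℂ) :
    (M * c * Mᴴ * b).trace =
      ∑ i, ∑ j, ∑ k, ∑ l, c j l * b k i * (M i j * star (M k l)) := by
  simp only [Matrix.trace, Matrix.diag_apply, Matrix.mul_apply, Matrix.conjTranspose_apply,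
    Finset.sum_mul]
  refine Finset.sum_congr rfl fun i _ => ?_
  rw [Finset.sum_congr rfl fun k _ => Finset.sum_comm, Finset.sum_comm]
  refine Finset.sum_congr rfl fun j _ => Finset.sum_congr rfl fun k _ =>
    Finset.sum_congr rfl fun l _ => by ring

/-- For `N ≥ 2`, an antisymmetric `a` (`aᵗ = −a`), `A = (0, a; a*, 0)` and `B = diag(b, c)`,
averaging `Tr(U*AUBU*AUB)` over `U = diag(V, V̄)` with `V` Haar-distributed on `U(N)` gives
`Tr(A²)·(Tr(b)·Tr(c) − Tr(b·cᵗ)) / (N(N−1))`. -/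
theorem blockdiag_unitary_fourth_moment_antisym (N : ℕ) (hN : 2 ≤ N)
    (a b c : Matrix (Fin N) (Fin N) ℂ) (ha : aᵀ = -a)
    (μ : Measure (Matrix (Fin N) (Fin N) ℂ)) [IsProbabilityMeasure μ]
    (hmem : ∀ᵐ V ∂μ, V ∈ Matrix.unitaryGroup (Fin N) ℂ)
    (hinv : ∀ S ∈ Matrix.unitaryGroup (Fin N) ℂ, μ.map (fun V => S * V) = μ) :
    ∫ V, ((Ublk V)ᴴ * Matrix.fromBlocks 0 a aᴴ 0 * Ublk V * Matrix.fromBlocks b 0 0 c *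
        (Ublk V)ᴴ * Matrix.fromBlocks 0 a aᴴ 0 * Ublk V * Matrix.fromBlocks b 0 0 c).trace ∂μ =
      (Matrix.fromBlocks 0 a aᴴ (0 : Matrix (Fin N) (Fin N) ℂ) *
          Matrix.fromBlocks 0 a aᴴ 0).trace *
        (b.trace * c.trace - (b * cᵀ).trace) / ((N : ℂ) * ((N : ℂ) - 1)) := by
  have htr : (Matrix.fromBlocks 0 a aᴴ (0 : Matrix (Fin N) (Fin N) ℂ) *
      Matrix.fromBlocks 0 a aᴴ 0).trace = 2 * (a * aᴴ).trace := by
    rw [Matrix.fromBlocks_multiply, trace_fromBlocks]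
    simp only [mul_zero, zero_add, add_zero]
    rw [Matrix.trace_mul_comm aᴴ a, two_mul]
  simp only [trace_Ublk_conj, htr, trace_mul_mul_conjTranspose_mul]
  have hi4 := fun i j k l : Fin N =>
    (integrable_entry_mul_star ha hmem i j k l).const_mul (c j l * b k i)
  have hi3 := fun i j k => integrable_finsetSum Finset.univ fun l _ => hi4 i j k l
  have hi2 := fun i j => integrable_finsetSum Finset.univ fun k _ => hi3 i j k
  have hi1 := fun i => integrable_finsetSum Finset.univ fun j _ => hi2 i j
  rw [integral_const_mul, integral_finsetSum _ fun i _ => hi1 i]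
  simp only [integral_finsetSum _ fun j _ => hi2 _ j]
  simp only [integral_finsetSum _ fun k _ => hi3 _ _ k]
  simp only [integral_finsetSum _ fun l _ => hi4 _ _ _ l, integral_const_mul,
    integral_entry_mul_star hN ha hmem hinv]
  simp only [mul_left_comm _ ((a * aᴴ).trace / _), ← Finset.mul_sum]
  have hsum : ∑ i, ∑ j, ∑ k, ∑ l, c j l * b k i *
      ((if i = k then 1 else 0) * (if j = l then 1 else 0) -
        (if i = l then 1 else 0) * (if j = k then 1 else 0)) =
      b.trace * c.trace - (b * cᵀ).trace := by
    simp only [mul_sub, Finset.sum_sub_distrib, mul_ite, mul_one, mul_zero]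
    simp only [Finset.sum_ite_eq, Finset.mem_univ, if_true, Matrix.trace, Matrix.diag_apply,
      Matrix.mul_apply, Matrix.transpose_apply, Finset.sum_mul_sum]
    simp only [Finset.sum_ite_irrel, Finset.sum_const_zero, Finset.sum_ite_eq, Finset.mem_univ,
      if_true]
    rw [Finset.sum_comm (f := fun x y => c y x * b y x)]
    simp only [mul_comm]
  rw [hsum]
  ring
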